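/- Let G be a finite connected triangle-free simple graph. Then G is 2-γ'MB-critical if and only if G belongs to the family 𝓑 or G is isomorphic to the cycle C₅ on five vertices. -/

import Mathlib

/-- `D` is a dominating set of `G`: every vertex not in `D` has a neighbor in `D`. -/
def Dominating {V : Type*} (G : SimpleGraph V) (D : Set V) : Prop :=
  ∀ v, v ∉ D → ∃ d ∈ D, G.Adj d v

/-- Dominator wins the S-game on `G` within one move. -/
def WinsWithin1 {V : Type*} (G : SimpleGraph V) : Prop :=
  ∀ s₁ : V, ∃ d₁, d₁ ≠ s₁ ∧ Dominating G {d₁}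

/-- Dominator wins the S-game on `G` within two moves. -/
def WinsWithin2 {V : Type*} (G : SimpleGraph V) : Prop :=
  ∀ s₁ : V, ∃ d₁, d₁ ≠ s₁ ∧
    (Dominating G {d₁} ∨
      ∀ s₂, s₂ ∉ ({s₁, d₁} : Set V) →
        ∃ d₂, d₂ ∉ ({s₁, d₁, s₂} : Set V) ∧ Dominating G {d₁, d₂})

/-- `γ'MB(G) = 2`: Dominator wins the S-game within two moves but not within one. -/
def MBPrimeEqTwo {V : Type*} (G : SimpleGraph V) : Prop :=
  WinsWithin2 G ∧ ¬ WinsWithin1 G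

/-- `G` is `2`-`γ'MB`-critical: `γ'MB(G) = 2` and for every edge `e`, Dominator does not
win the S-game on `G - e` within two moves. -/
def Critical2 {V : Type*} (G : SimpleGraph V) : Prop :=
  MBPrimeEqTwo G ∧ ∀ u v : V, G.Adj u v → ¬ WinsWithin2 (G.deleteEdges {s(u, v)})

/-- `G` belongs to the family `𝓑`: either `G ≅ K_{2,m}` with `m ≥ 3`, or `G` is bipartite
with parts `V₁, V₂` of sizes `m, n ≥ 3`, exactly two vertices of `V₁` have degree `n`,
exactly two vertices of `V₂` have degree `m`, and all other vertices have degree `2`. -/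
def InFamilyB {V : Type*} (G : SimpleGraph V) : Prop :=
  (∃ m : ℕ, 3 ≤ m ∧ Nonempty (G ≃g completeBipartiteGraph (Fin 2) (Fin m))) ∨
  (∃ V₁ V₂ : Set V, Disjoint V₁ V₂ ∧ V₁ ∪ V₂ = Set.univ ∧
    3 ≤ V₁.ncard ∧ 3 ≤ V₂.ncard ∧
    (∀ u v, G.Adj u v → (u ∈ V₁ ∧ v ∈ V₂) ∨ (u ∈ V₂ ∧ v ∈ V₁)) ∧
    {v ∈ V₁ | (G.neighborSet v).ncard = V₂.ncard}.ncard = 2 ∧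
    (∀ v ∈ V₁, (G.neighborSet v).ncard = V₂.ncard ∨ (G.neighborSet v).ncard = 2) ∧
    {v ∈ V₂ | (G.neighborSet v).ncard = V₁.ncard}.ncard = 2 ∧
    (∀ v ∈ V₂, (G.neighborSet v).ncard = V₁.ncard ∨ (G.neighborSet v).ncard = 2))

/-- Every vertex equals or is adjacent to one of `a`, `b`. -/
def DominatingPair {V : Type*} (G : SimpleGraph V) (a b : V) : Prop :=
  ∀ v, v = a ∨ v = b ∨ G.Adj a v ∨ G.Adj b v

/-- After every first move `s` of Staller, some vertex forms dominating pairs with two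
distinct vertices, all three of them different from `s`. -/
def HasDoubleReply {V : Type*} (G : SimpleGraph V) : Prop :=
  ∀ s, ∃ d p q, d ≠ s ∧ p ≠ s ∧ q ≠ s ∧ p ≠ d ∧ q ≠ d ∧ p ≠ q ∧
    DominatingPair G d p ∧ DominatingPair G d q

/-- `G` is the bipartite graph with parts `S` and `Sᶜ` in which `x, x' ∈ S` are adjacent to all
of `Sᶜ`, `y, y' ∉ S` are adjacent to all of `S`, and there are no other edges. -/
structure IsDoubleBiclique {V : Type*} (G : SimpleGraph V) (S : Set V) (x x' y y' : V) :
    Prop where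
  hx : x ∈ S
  hx' : x' ∈ S
  hxx' : x ≠ x'
  hy : y ∉ S
  hy' : y' ∉ S
  hyy' : y ≠ y'
  adj : ∀ u v, G.Adj u v ↔
    (u ∈ S ∧ v ∉ S ∧ (u = x ∨ u = x' ∨ v = y ∨ v = y')) ∨
    (v ∈ S ∧ u ∉ S ∧ (v = x ∨ v = x' ∨ u = y ∨ u = y'))

section Game

variable {V : Type*} {G : SimpleGraph V}

theorem dominating_pair_iff {a b : V} : Dominating G {a, b} ↔ DominatingPair G a b := by
  unfold Dominating DominatingPair
  simp only [Set.mem_insert_iff, Set.mem_singleton_iff, exists_eq_or_imp, exists_eq_left]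
  grind

theorem Dominating.dominatingPair {a : V} (h : Dominating G {a}) (b : V) :
    DominatingPair G a b := by
  intro v
  have := h v
  simp only [Set.mem_singleton_iff, exists_eq_left] at this
  grind

theorem HasDoubleReply.winsWithin2 (h : HasDoubleReply G) : WinsWithin2 G := by
  intro s
  obtain ⟨d, p, q, hd, hp, hq, hpd, hqd, hpq, h1, h2⟩ := h s
  refine ⟨d, hd, Or.inr fun t ht => ?_⟩
  by_cases hpt : p = t
  · exact ⟨q, by simp; grind, dominating_pair_iff.2 h2⟩
  · exact ⟨p, by simp; grind, dominating_pair_iff.2 h1⟩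

theorem exists_double_reply_of_not_dominating {s d t : V}
    (hds : d ≠ s) (hts : t ≠ s) (htd : t ≠ d)
    (h : ∀ s₂, s₂ ∉ ({s, d} : Set V) →
        ∃ d₂, d₂ ∉ ({s, d, s₂} : Set V) ∧ Dominating G {d, d₂}) :
    ∃ d p q, d ≠ s ∧ p ≠ s ∧ q ≠ s ∧ p ≠ d ∧ q ≠ d ∧ p ≠ q ∧
      DominatingPair G d p ∧ DominatingPair G d q := by
  simp only [Set.mem_insert_iff, Set.mem_singleton_iff, dominating_pair_iff] at h
  obtain ⟨p, hp, hp'⟩ := h t (by grind)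
  obtain ⟨q, hq, hq'⟩ := h p (by grind)
  exact ⟨d, p, q, by grind⟩

theorem WinsWithin2.hasDoubleReply {a b c e : V} (hab : a ≠ b) (hac : a ≠ c) (hae : a ≠ e)
    (hbc : b ≠ c) (hbe : b ≠ e) (hce : c ≠ e) (h : WinsWithin2 G) : HasDoubleReply G := by
  intro s
  obtain ⟨d, hd, hdom | hmove⟩ := h s
  · obtain ⟨p, q, hp⟩ : ∃ p q, p ≠ s ∧ q ≠ s ∧ p ≠ d ∧ q ≠ d ∧ p ≠ q := by
      by_cases a = s <;> by_cases b = s <;> by_cases c = s <;> by_cases e = s <;>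
      by_cases a = d <;> by_cases b = d <;> by_cases c = d <;> by_cases e = d <;>
      first | (exfalso; grind) | exact ⟨a, b, by grind⟩ | exact ⟨a, c, by grind⟩ |
        exact ⟨a, e, by grind⟩ | exact ⟨b, c, by grind⟩ | exact ⟨b, e, by grind⟩ |
        exact ⟨c, e, by grind⟩
    exact ⟨d, p, q, by grind [Dominating.dominatingPair]⟩
  · obtain ⟨t, ht, ht'⟩ : ∃ t, t ≠ s ∧ t ≠ d := by
      by_cases a = s ∨ a = d
      · by_cases b = s ∨ b = d
        · exact ⟨c, by grind⟩
        · exact ⟨b, by grind⟩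
      · exact ⟨a, by grind⟩
    exact exists_double_reply_of_not_dominating hd ht ht' hmove

theorem mem_of_connected {S : Set V} (hconn : G.Connected) {a : V} (ha : a ∈ S)
    (hS : ∀ u v, u ∈ S → G.Adj u v → v ∈ S) (b : V) : b ∈ S := by
  obtain ⟨w⟩ := hconn.preconnected a b
  induction w with
  | nil => exact ha
  | cons h _ ih => exact ih (hS _ _ ha h)

theorem MBPrimeEqTwo.hasDoubleReply (hconn : G.Connected) (h : MBPrimeEqTwo G) :
    HasDoubleReply G := by
  obtain ⟨h2, h1⟩ := h
  unfold WinsWithin1 at h1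
  push Not at h1
  obtain ⟨s, hs⟩ := h1
  obtain ⟨d, hd, hdom | hmove⟩ := h2 s
  · exact absurd hdom (hs d hd)
  · obtain ⟨t, ht, ht'⟩ : ∃ t, t ≠ s ∧ t ≠ d := by
      by_contra! hcon
      have hsd : G.Adj d s := by
        by_contra hn
        have := mem_of_connected (S := {d}) hconn rfl (a := d)
          (fun u v hu huv => by
            simp only [Set.mem_singleton_iff] at hu ⊢
            have := hcon v
            grind) s
        exact hd this.symm
      refine hs d hd fun v hv => ⟨d, rfl, ?_⟩
      simp only [Set.mem_singleton_iff] at hv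
      have := hcon v
      grind
    obtain ⟨d, p, q, h⟩ := exists_double_reply_of_not_dominating hd ht ht' hmove
    exact h2.hasDoubleReply (a := s) (b := d) (c := p) (e := q)
      (by grind) (by grind) (by grind) (by grind) (by grind) (by grind)

theorem WinsWithin2.mono {G' : SimpleGraph V} (hle : G' ≤ G) (h : WinsWithin2 G') :
    WinsWithin2 G := by
  have key : ∀ D, Dominating G' D → Dominating G D := fun D hD v hv => by
    obtain ⟨d, hd, hdv⟩ := hD v hv
    exact ⟨d, hd, hle hdv⟩
  intro s
  obtain ⟨d, hd, hdom | hmove⟩ := h s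
  · exact ⟨d, hd, Or.inl (key _ hdom)⟩
  · refine ⟨d, hd, Or.inr fun t ht => ?_⟩
    obtain ⟨e, he, he'⟩ := hmove t ht
    exact ⟨e, he, key _ he'⟩

theorem Critical2.eq_of_le {G' : SimpleGraph V} (hG : Critical2 G) (hle : G' ≤ G)
    (h : WinsWithin2 G') : G' = G := by
  refine le_antisymm hle fun u v huv => ?_
  by_contra hn
  refine hG.2 u v huv (h.mono fun a b hab => ?_)
  rw [SimpleGraph.deleteEdges_adj]
  refine ⟨hle hab, fun hmem => ?_⟩
  simp only [Set.mem_singleton_iff, Sym2.eq_iff] at hmem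
  rcases hmem with ⟨rfl, rfl⟩ | ⟨rfl, rfl⟩
  · exact hn hab
  · exact hn hab.symm

theorem deleteEdges_pair_adj {u v a b : V} : (G.deleteEdges {s(u, v)}).Adj a b ↔
    G.Adj a b ∧ ¬ ((a = u ∧ b = v) ∨ (a = v ∧ b = u)) := by
  simp [SimpleGraph.deleteEdges_adj]

theorem hasDoubleReply_of_two_edges {a b c e : V} (hac : a ≠ c) (hae : a ≠ e) (hbc : b ≠ c)
    (hbe : b ≠ e) (hab : G.Adj a b) (hce : G.Adj c e)
    (hV : ∀ v, v = a ∨ v = b ∨ v = c ∨ v = e) : HasDoubleReply G := by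
  have h1 := hab.symm
  have h2 := hce.symm
  have h3 := hab.ne
  have h4 := hce.ne
  have e1 : ∀ a' c', (a' = a ∨ a' = b) → (c' = c ∨ c' = e) → DominatingPair G a' c' :=
    fun a' c' ha' hc' v => by
      have := hV v
      grind
  have e2 : ∀ a' c', (a' = a ∨ a' = b) → (c' = c ∨ c' = e) → DominatingPair G c' a' :=
    fun a' c' ha' hc' v => by
      have := e1 a' c' ha' hc' v
      tauto
  intro s
  rcases hV s with rfl | rfl | rfl | rfl
  · exact ⟨b, c, e, by grind⟩
  · exact ⟨a, c, e, by grind⟩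
  · exact ⟨e, a, b, by grind⟩
  · exact ⟨c, a, b, by grind⟩

theorem not_critical2_of_path {a b c e : V} (hae : a ≠ e) (hbc : b ≠ c)
    (hbe : b ≠ e) (hab : G.Adj a b) (hce : G.Adj c e) (hac : G.Adj a c)
    (hV : ∀ v, v = a ∨ v = b ∨ v = c ∨ v = e) : ¬ Critical2 G := by
  intro hG
  refine hG.2 a c hac (HasDoubleReply.winsWithin2
    (hasDoubleReply_of_two_edges hac.ne hae hbc hbe ?_ ?_ hV))
  · have := hab.ne
    rw [deleteEdges_pair_adj]; grind
  · have := hce.ne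
    rw [deleteEdges_pair_adj]; grind

end Game

namespace IsDoubleBiclique

variable {V : Type*} {G : SimpleGraph V} {S : Set V} {x x' y y' : V}

theorem compl (h : IsDoubleBiclique G S x x' y y') : IsDoubleBiclique G Sᶜ y y' x x' where
  hx := h.hy
  hx' := h.hy'
  hxx' := h.hyy'
  hy := fun hn => hn h.hx
  hy' := fun hn => hn h.hx'
  hyy' := h.hxx'
  adj u v := by
    rw [h.adj]
    simp only [Set.mem_compl_iff]
    tauto

theorem swap_left (h : IsDoubleBiclique G S x x' y y') : IsDoubleBiclique G S x' x y y' where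
  hx := h.hx'
  hx' := h.hx
  hxx' := h.hxx'.symm
  hy := h.hy
  hy' := h.hy'
  hyy' := h.hyy'
  adj u v := by rw [h.adj]; tauto

theorem swap_right (h : IsDoubleBiclique G S x x' y y') : IsDoubleBiclique G S x x' y' y :=
  h.compl.swap_left.compl |> fun h' => by rwa [compl_compl] at h'

theorem hasDoubleReply (h : IsDoubleBiclique G S x x' y y') : HasDoubleReply G := by
  obtain ⟨hx, hx', hxx', hy, hy', hyy', adj⟩ := h
  have e1 : DominatingPair G x y := fun v => by by_cases v ∈ S <;> simp only [adj] <;> tauto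
  have e2 : DominatingPair G x y' := fun v => by by_cases v ∈ S <;> simp only [adj] <;> tauto
  have e3 : DominatingPair G x' y := fun v => by by_cases v ∈ S <;> simp only [adj] <;> tauto
  have e4 : DominatingPair G x' y' := fun v => by by_cases v ∈ S <;> simp only [adj] <;> tauto
  have symm : ∀ {a b}, DominatingPair G a b → DominatingPair G b a :=
    fun h v => by have := h v; tauto
  have e5 := symm e1
  have e6 := symm e2
  have e7 := symm e3
  have e8 := symm e4
  intro s
  by_cases h1 : s = x
  · exact ⟨x', y, y', by grind⟩
  by_cases h2 : s = x'
  · exact ⟨x, y, y', by grind⟩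
  by_cases h3 : s = y
  · exact ⟨y', x, x', by grind⟩
  · exact ⟨y, x, x', by grind⟩

theorem not_winsWithin1 (h : IsDoubleBiclique G S x x' y y') : ¬ WinsWithin1 G := by
  intro hw
  obtain ⟨d, -, hdom⟩ := hw x
  have hp := hdom.dominatingPair d
  obtain ⟨hx, hx', hxx', hy, hy', hyy', adj⟩ := h
  have h1 := hp x
  have h2 := hp x'
  have h3 := hp y
  have h4 := hp y'
  simp only [adj] at h1 h2 h3 h4
  grind

theorem winsWithin2_deleteEdges_hasDoubleReply (h : IsDoubleBiclique G S x x' y y') {u v : V}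
    (hw : WinsWithin2 (G.deleteEdges {s(u, v)})) :
    HasDoubleReply (G.deleteEdges {s(u, v)}) :=
  hw.hasDoubleReply (a := x) (b := x') (c := y) (e := y') h.hxx'
    (fun e => h.hy (e ▸ h.hx)) (fun e => h.hy' (e ▸ h.hx)) (fun e => h.hy (e ▸ h.hx'))
    (fun e => h.hy' (e ▸ h.hx')) h.hyy'

theorem not_winsWithin2_delete_leaf_edge (h : IsDoubleBiclique G S x x' y y') {b : V}
    (hb : b ∉ S) (hby : b ≠ y) (hby' : b ≠ y') :
    ¬ WinsWithin2 (G.deleteEdges {s(x, b)}) := by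
  intro hw
  obtain ⟨d, p, q, hd, hp, hq, hpd, hqd, hpq, h1, h2⟩ :=
    h.winsWithin2_deleteEdges_hasDoubleReply hw x'
  obtain ⟨hx, hx', hxx', hy, hy', hyy', adj⟩ := h
  have key : ∀ u v, u ≠ x' → v ≠ x' → DominatingPair (G.deleteEdges {s(x, b)}) u v →
      (u = b ∧ v = x) ∨ (u = x ∧ v = b) := by
    intro u v hu hv huv
    have i1 := huv b
    have i2 := huv y
    have i3 := huv y'
    have i4 := huv x
    simp only [deleteEdges_pair_adj, adj] at i1 i2 i3 i4
    grind
  have := key d p hd hp h1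
  have := key d q hd hq h2
  grind

theorem not_winsWithin2_delete_center_edge (h : IsDoubleBiclique G S x x' y y') {a b : V}
    (ha : a ∈ S) (hax : a ≠ x) (hax' : a ≠ x') (hb : b ∉ S) (hby : b ≠ y) (hby' : b ≠ y') :
    ¬ WinsWithin2 (G.deleteEdges {s(x, y)}) := by
  intro hw
  obtain ⟨d, p, q, hd, hp, hq, hpd, hqd, hpq, h1, h2⟩ :=
    h.winsWithin2_deleteEdges_hasDoubleReply hw x'
  obtain ⟨hx, hx', hxx', hy, hy', hyy', adj⟩ := h
  have key : ∀ u v, DominatingPair (G.deleteEdges {s(x, y)}) u v →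
      (u = x ∧ v = y) ∨ (u = y ∧ v = x) ∨ (u = x' ∧ v = y') ∨ (u = y' ∧ v = x') ∨
      (u = a ∧ v = b) ∨ (u = b ∧ v = a) := by
    intro u v huv
    have i1 := huv b
    have i2 := huv y
    have i3 := huv y'
    have i4 := huv x
    have i5 := huv x'
    have i6 := huv a
    simp only [deleteEdges_pair_adj, adj] at i1 i2 i3 i4 i5 i6
    by_cases u ∈ S <;> by_cases v ∈ S <;> grind
  have := key d p h1
  have := key d q h2
  grind

theorem of_left_eq_pair (h : IsDoubleBiclique G S x x' y y') (hS : ∀ v ∈ S, v = x ∨ v = x')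
    {z z' : V} (hz : z ∉ S) (hz' : z' ∉ S) (hzz' : z ≠ z') :
    IsDoubleBiclique G S x x' z z' where
  hx := h.hx
  hx' := h.hx'
  hxx' := h.hxx'
  hy := hz
  hy' := hz'
  hyy' := hzz'
  adj u v := by
    rw [h.adj]
    have := hS u
    have := hS v
    grind

theorem not_winsWithin2_delete_left_edge (h : IsDoubleBiclique G S x x' y y') {b : V}
    (hb : b ∉ S) (hby : b ≠ y) (hby' : b ≠ y') {v : V} (hv : v ∉ S) :
    ¬ WinsWithin2 (G.deleteEdges {s(x, v)}) := by
  by_cases hvy : v ≠ y ∧ v ≠ y'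
  · exact h.not_winsWithin2_delete_leaf_edge hv hvy.1 hvy.2
  · by_cases hS : ∀ w ∈ S, w = x ∨ w = x'
    · obtain ⟨z, z', hz, hz', hzz', hvz, hvz'⟩ :
          ∃ z z', z ∉ S ∧ z' ∉ S ∧ z ≠ z' ∧ v ≠ z ∧ v ≠ z' := by
        have := h.hyy'
        have := h.hy
        have := h.hy'
        by_cases v = y
        · exact ⟨y', b, by grind⟩
        · exact ⟨y, b, by grind⟩
      exact (h.of_left_eq_pair hS hz hz' hzz').not_winsWithin2_delete_leaf_edge hv hvz hvz'
    · push Not at hS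
      obtain ⟨a, ha, hax, hax'⟩ := hS
      by_cases hvy' : v = y
      · subst hvy'
        exact h.not_winsWithin2_delete_center_edge ha hax hax' hb hby hby'
      · obtain rfl : v = y' := by tauto
        exact h.swap_right.not_winsWithin2_delete_center_edge ha hax hax' hb hby' hby

theorem critical2_of_not_mem (h : IsDoubleBiclique G S x x' y y') {b : V}
    (hb : b ∉ S) (hby : b ≠ y) (hby' : b ≠ y') : Critical2 G := by
  refine ⟨⟨h.hasDoubleReply.winsWithin2, h.not_winsWithin1⟩, ?_⟩
  have key : ∀ u v, u ∈ S → v ∉ S → (u = x ∨ u = x' ∨ v = y ∨ v = y') →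
      ¬ WinsWithin2 (G.deleteEdges {s(u, v)}) := by
    intro u v hu hv huv
    by_cases hux : u = x
    · subst hux
      exact h.not_winsWithin2_delete_left_edge hb hby hby' hv
    by_cases hux' : u = x'
    · subst hux'
      exact h.swap_left.not_winsWithin2_delete_left_edge hb hby hby' hv
    have hu' : u ∉ Sᶜ := fun hn => hn hu
    rw [Sym2.eq_swap]
    by_cases hvy : v = y
    · subst hvy
      exact h.compl.not_winsWithin2_delete_leaf_edge hu' hux hux'
    · obtain rfl : v = y' := by tauto
      exact h.compl.swap_left.not_winsWithin2_delete_leaf_edge hu' hux hux'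
  intro u v huv
  rcases (h.adj u v).1 huv with ⟨h1, h2, h3⟩ | ⟨h1, h2, h3⟩
  · exact key u v h1 h2 h3
  · rw [Sym2.eq_swap]
    exact key v u h1 h2 h3

theorem critical2 (h : IsDoubleBiclique G S x x' y y') {b : V}
    (hbx : b ≠ x) (hbx' : b ≠ x') (hby : b ≠ y) (hby' : b ≠ y') : Critical2 G := by
  by_cases hb : b ∈ S
  · exact h.compl.critical2_of_not_mem (fun hn => hn hb) hbx hbx'
  · exact h.critical2_of_not_mem hb hby hby'

theorem neighborSet_left (h : IsDoubleBiclique G S x x' y y') : G.neighborSet x = Sᶜ := by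
  ext v
  have := h.hx
  simp only [SimpleGraph.mem_neighborSet, h.adj, Set.mem_compl_iff]
  tauto

theorem neighborSet_of_mem (h : IsDoubleBiclique G S x x' y y') {a : V} (ha : a ∈ S)
    (hax : a ≠ x) (hax' : a ≠ x') : G.neighborSet a = {y, y'} := by
  ext v
  have := h.hy
  have := h.hy'
  simp only [SimpleGraph.mem_neighborSet, h.adj, Set.mem_insert_iff, Set.mem_singleton_iff]
  grind

theorem ncard_degree_conditions (h : IsDoubleBiclique G S x x' y y') (hS : 3 ≤ Sᶜ.ncard) :
    {v ∈ S | (G.neighborSet v).ncard = Sᶜ.ncard}.ncard = 2 ∧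
    (∀ v ∈ S, (G.neighborSet v).ncard = Sᶜ.ncard ∨ (G.neighborSet v).ncard = 2) := by
  have key : ∀ v ∈ S, v ≠ x → v ≠ x' → (G.neighborSet v).ncard = 2 := fun v hv h1 h2 => by
    rw [h.neighborSet_of_mem hv h1 h2, Set.ncard_pair h.hyy']
  have e1 : (G.neighborSet x).ncard = Sᶜ.ncard := by rw [h.neighborSet_left]
  have e2 : (G.neighborSet x').ncard = Sᶜ.ncard := by rw [h.swap_left.neighborSet_left]
  refine ⟨?_, fun v hv => ?_⟩
  · rw [← Set.ncard_pair h.hxx']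
    congr 1
    ext v
    have := h.hx
    have := h.hx'
    have := key v
    simp only [Set.mem_ofPred_eq, Set.mem_insert_iff, Set.mem_singleton_iff]
    grind
  · by_cases h1 : v = x
    · exact .inl (h1 ▸ e1)
    by_cases h2 : v = x'
    · exact .inl (h2 ▸ e2)
    · exact .inr (key v hv h1 h2)

theorem three_le_ncard [Finite V] {b : V} (h : IsDoubleBiclique G S x x' y y') (hb : b ∈ S)
    (hbx : b ≠ x) (hbx' : b ≠ x') : 3 ≤ S.ncard := by
  have h3 : ({b, x, x'} : Set V).ncard = 3 := by
    rw [Set.ncard_eq_three]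
    exact ⟨b, x, x', hbx, hbx', h.hxx', rfl⟩
  rw [← h3]
  refine Set.ncard_le_ncard ?_ (Set.toFinite _)
  have := h.hx
  have := h.hx'
  intro v
  simp only [Set.mem_insert_iff, Set.mem_singleton_iff]
  grind

theorem inFamilyB_of_not_mem [Finite V] (h : IsDoubleBiclique G S x x' y y') {b : V}
    (hb : b ∉ S) (hby : b ≠ y) (hby' : b ≠ y') : InFamilyB G := by
  classical
  have hcard := h.compl.three_le_ncard hb hby hby'
  by_cases hS : ∀ w ∈ S, w = x ∨ w = x'
  · left
    refine ⟨Sᶜ.ncard, hcard, ?_⟩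
    have hS2 : S = {x, x'} := by
      ext v
      have := h.hx
      have := h.hx'
      have := hS v
      simp only [Set.mem_insert_iff, Set.mem_singleton_iff]
      grind
    have hSc : Nat.card S = 2 := by
      rw [Nat.card_coe_set_eq, hS2, Set.ncard_pair h.hxx']
    let f : S ≃ Fin 2 := Finite.equivFinOfCardEq hSc
    let g : (Sᶜ : Set V) ≃ Fin Sᶜ.ncard := Finite.equivFinOfCardEq (Nat.card_coe_set_eq _)
    let e : V ≃ Fin 2 ⊕ Fin Sᶜ.ncard := (Equiv.Set.sumCompl S).symm.trans (f.sumCongr g)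
    have e1 : ∀ v (hv : v ∈ S), e v = Sum.inl (f ⟨v, hv⟩) := fun v hv => by
      simp [e, Equiv.Set.sumCompl_symm_apply_of_mem hv]
    have e2 : ∀ v (hv : v ∉ S), e v = Sum.inr (g ⟨v, hv⟩) := fun v hv => by
      simp [e, Equiv.Set.sumCompl_symm_apply_of_notMem hv]
    refine ⟨⟨e, fun {u v} => ?_⟩⟩
    rw [h.adj]
    have := hS u
    have := hS v
    by_cases hu : u ∈ S <;> by_cases hv : v ∈ S
    · rw [e1 u hu, e1 v hv]; simp; tauto
    · rw [e1 u hu, e2 v hv]; simp; tauto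
    · rw [e2 u hu, e1 v hv]; simp; tauto
    · rw [e2 u hu, e2 v hv]; simp; tauto
  · push Not at hS
    obtain ⟨a, ha, hax, hax'⟩ := hS
    have hcard' := h.three_le_ncard ha hax hax'
    obtain ⟨c1, c2⟩ := h.ncard_degree_conditions hcard
    obtain ⟨c3, c4⟩ := h.compl.ncard_degree_conditions (by rwa [compl_compl])
    rw [compl_compl] at c3 c4
    refine Or.inr ⟨S, Sᶜ, disjoint_compl_right, Set.union_compl_self S, hcard', hcard, ?_,
      c1, c2, c3, c4⟩
    intro u v huv
    rw [h.adj] at huv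
    simp only [Set.mem_compl_iff]
    tauto

theorem inFamilyB [Finite V] (h : IsDoubleBiclique G S x x' y y') {b : V}
    (hbx : b ≠ x) (hbx' : b ≠ x') (hby : b ≠ y) (hby' : b ≠ y') : InFamilyB G := by
  by_cases hb : b ∈ S
  · exact h.compl.inFamilyB_of_not_mem (fun hn => hn hb) hbx hbx'
  · exact h.inFamilyB_of_not_mem hb hby hby'

end IsDoubleBiclique

section Family

variable {V : Type*} {G : SimpleGraph V}

theorem isDoubleBiclique_of_iso {m : ℕ} (hm : 3 ≤ m)
    (e : G ≃g completeBipartiteGraph (Fin 2) (Fin m)) :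
    ∃ S x x' y y' b, IsDoubleBiclique G S x x' y y' ∧ b ≠ x ∧ b ≠ x' ∧ b ≠ y ∧ b ≠ y' := by
  refine ⟨{v | (e v).isLeft}, e.symm (.inl 0), e.symm (.inl 1), e.symm (.inr ⟨0, by omega⟩),
    e.symm (.inr ⟨1, by omega⟩), e.symm (.inr ⟨2, by omega⟩), ⟨by simp, by simp, by simp,
    by simp, by simp, by simp, fun u v => ?_⟩, by simp, by simp, by simp, by simp⟩
  obtain ⟨u, rfl⟩ := e.symm.surjective u
  obtain ⟨v, rfl⟩ := e.symm.surjective v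
  rw [e.symm.map_adj_iff]
  rcases u with u | u <;> rcases v with v | v <;> simp <;> omega

theorem isDoubleBiclique_of_degrees [Finite V] {V₁ V₂ : Set V} (hdisj : Disjoint V₁ V₂)
    (hunion : V₁ ∪ V₂ = Set.univ) (h1 : 3 ≤ V₁.ncard)
    (hadj : ∀ u v, G.Adj u v → (u ∈ V₁ ∧ v ∈ V₂) ∨ (u ∈ V₂ ∧ v ∈ V₁))
    (c1 : {v ∈ V₁ | (G.neighborSet v).ncard = V₂.ncard}.ncard = 2)
    (c2 : ∀ v ∈ V₁, (G.neighborSet v).ncard = V₂.ncard ∨ (G.neighborSet v).ncard = 2)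
    (c3 : {v ∈ V₂ | (G.neighborSet v).ncard = V₁.ncard}.ncard = 2) :
    ∃ S x x' y y' b, IsDoubleBiclique G S x x' y y' ∧ b ≠ x ∧ b ≠ x' ∧ b ≠ y ∧ b ≠ y' := by
  obtain rfl : V₂ = V₁ᶜ :=
    (IsCompl.compl_eq ⟨hdisj, codisjoint_iff.2 hunion⟩).symm
  simp only [Set.mem_compl_iff] at hadj
  have full : ∀ v ∈ V₁, (G.neighborSet v).ncard = V₁ᶜ.ncard → ∀ w ∉ V₁, G.Adj v w := by
    intro v hv hc w hw
    have := Set.eq_of_subset_of_ncard_le (s := G.neighborSet v) (t := V₁ᶜ)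
      (fun w hw => by have := hadj v w hw; simp only [Set.mem_compl_iff]; tauto) hc.ge
    have hw' : w ∈ V₁ᶜ := hw
    rwa [← this] at hw'
  have full' : ∀ v ∉ V₁, (G.neighborSet v).ncard = V₁.ncard → ∀ w ∈ V₁, G.Adj v w := by
    intro v hv hc w hw
    have := Set.eq_of_subset_of_ncard_le (s := G.neighborSet v) (t := V₁)
      (fun w hw => by have := hadj v w hw; tauto) hc.ge
    rwa [← this] at hw
  obtain ⟨x, x', hxx', hX⟩ := Set.ncard_eq_two.1 c1
  obtain ⟨y, y', hyy', hY⟩ := Set.ncard_eq_two.1 c3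
  have hX' : ∀ v, v ∈ V₁ ∧ (G.neighborSet v).ncard = V₁ᶜ.ncard ↔ v = x ∨ v = x' := fun v => by
    simpa using Set.ext_iff.1 hX v
  have hY' : ∀ v, v ∉ V₁ ∧ (G.neighborSet v).ncard = V₁.ncard ↔ v = y ∨ v = y' := fun v => by
    simpa using Set.ext_iff.1 hY v
  have hx := (hX' x).2 (.inl rfl)
  have hx' := (hX' x').2 (.inr rfl)
  have hy := (hY' y).2 (.inl rfl)
  have hy' := (hY' y').2 (.inr rfl)
  have low : ∀ v ∈ V₁, v ≠ x → v ≠ x' → ∀ w, G.Adj v w → w = y ∨ w = y' := by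
    intro v hv hvx hvx' w hw
    have hc : (G.neighborSet v).ncard = 2 := by
      have := hX' v
      have := c2 v hv
      tauto
    have := Set.eq_of_subset_of_ncard_le (s := {y, y'}) (t := G.neighborSet v) ?_
      (by rw [hc, Set.ncard_pair hyy'])
    · have hw' : w ∈ G.neighborSet v := hw
      rw [← this] at hw'
      simpa using hw'
    · rintro z (rfl | rfl)
      · exact (full' _ hy.1 hy.2 v hv).symm
      · exact (full' _ hy'.1 hy'.2 v hv).symm
  have spec : ∀ u v, u ∈ V₁ → v ∉ V₁ →
      (G.Adj u v ↔ (u = x ∨ u = x' ∨ v = y ∨ v = y')) := by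
    intro u v hu hv
    constructor
    · intro huv
      have := low u hu
      grind
    · rintro (rfl | rfl | rfl | rfl)
      · exact full _ hx.1 hx.2 v hv
      · exact full _ hx'.1 hx'.2 v hv
      · exact (full' _ hy.1 hy.2 u hu).symm
      · exact (full' _ hy'.1 hy'.2 u hu).symm
  obtain ⟨b, hb, hb'⟩ : ∃ b ∈ V₁, b ∉ ({x, x'} : Set V) := by
    refine Set.exists_mem_notMem_of_ncard_lt_ncard ?_
    rw [Set.ncard_pair hxx']
    omega
  simp only [Set.mem_insert_iff, Set.mem_singleton_iff, not_or] at hb'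
  refine ⟨V₁, x, x', y, y', b, ⟨hx.1, hx'.1, hxx', hy.1, hy'.1, hyy', fun u v => ?_⟩, hb'.1,
    hb'.2, fun e => hy.1 (e ▸ hb), fun e => hy'.1 (e ▸ hb)⟩
  have := spec u v
  have := spec v u
  have := hadj u v
  have := G.adj_comm u v
  grind

theorem InFamilyB.exists_isDoubleBiclique [Finite V] (h : InFamilyB G) :
    ∃ S x x' y y' b, IsDoubleBiclique G S x x' y y' ∧ b ≠ x ∧ b ≠ x' ∧ b ≠ y ∧ b ≠ y' := by
  rcases h with ⟨m, hm, ⟨e⟩⟩ | ⟨V₁, V₂, hdisj, hunion, h1, -, hadj, c1, c2, c3, -⟩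
  · exact isDoubleBiclique_of_iso hm e
  · exact isDoubleBiclique_of_degrees hdisj hunion h1 hadj c1 c2 c3

end Family

section Cycle

theorem HasDoubleReply.of_iso {V W : Type*} {G : SimpleGraph V} {H : SimpleGraph W}
    (e : G ≃g H) (h : HasDoubleReply G) : HasDoubleReply H := by
  have key : ∀ a b, DominatingPair G a b → DominatingPair H (e a) (e b) := by
    intro a b hab w
    obtain ⟨v, rfl⟩ := e.surjective w
    simpa only [e.injective.eq_iff, e.map_adj_iff] using hab v
  intro s
  obtain ⟨s, rfl⟩ := e.surjective s
  obtain ⟨d, p, q, hd, hp, hq, hpd, hqd, hpq, h1, h2⟩ := h s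
  exact ⟨e d, e p, e q, e.injective.ne hd, e.injective.ne hp, e.injective.ne hq,
    e.injective.ne hpd, e.injective.ne hqd, e.injective.ne hpq, key _ _ h1, key _ _ h2⟩

instance {V : Type*} [Fintype V] [DecidableEq V] (G : SimpleGraph V) [DecidableRel G.Adj]
    (a b : V) : Decidable (DominatingPair G a b) :=
  inferInstanceAs (Decidable (∀ v, v = a ∨ v = b ∨ G.Adj a v ∨ G.Adj b v))

instance {V : Type*} [DecidableEq V] (G : SimpleGraph V) [DecidableRel G.Adj] (u v : V) :
    DecidableRel (G.deleteEdges {s(u, v)}).Adj :=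
  fun _ _ => decidable_of_iff _ deleteEdges_pair_adj.symm

theorem hasDoubleReply_cycleGraph : HasDoubleReply (SimpleGraph.cycleGraph 5) := by
  unfold HasDoubleReply
  decide +kernel

theorem not_hasDoubleReply_delete_cycleGraph (u v : Fin 5)
    (huv : (SimpleGraph.cycleGraph 5).Adj u v) :
    ¬ HasDoubleReply ((SimpleGraph.cycleGraph 5).deleteEdges {s(u, v)}) := by
  unfold HasDoubleReply
  revert u v
  decide +kernel

theorem critical2_of_iso_cycleGraph {V : Type*} {G : SimpleGraph V}
    (e : G ≃g SimpleGraph.cycleGraph 5) : Critical2 G := by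
  refine ⟨⟨(hasDoubleReply_cycleGraph.of_iso e.symm).winsWithin2, fun hw => ?_⟩, ?_⟩
  · obtain ⟨d, -, hdom⟩ := hw (e.symm 0)
    have hp := hdom.dominatingPair d
    obtain ⟨d, rfl⟩ := e.symm.surjective d
    have hd : ∀ i, i = d ∨ (SimpleGraph.cycleGraph 5).Adj d i := fun i => by
      have := hp (e.symm i)
      simpa only [e.symm.injective.eq_iff, e.symm.map_adj_iff, or_self, ← or_assoc] using this
    have hnd : ∀ d : Fin 5, ¬ ∀ i, i = d ∨ (SimpleGraph.cycleGraph 5).Adj d i := by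
      decide +kernel
    exact hnd d hd
  · intro u v huv hw
    have hinj := e.symm.injective
    have hr := hw.hasDoubleReply (a := e.symm 0) (b := e.symm 1) (c := e.symm 2)
      (e := e.symm 3) (hinj.ne (by decide)) (hinj.ne (by decide)) (hinj.ne (by decide))
      (hinj.ne (by decide)) (hinj.ne (by decide)) (hinj.ne (by decide))
    let e' : G.deleteEdges {s(u, v)} ≃g
        (SimpleGraph.cycleGraph 5).deleteEdges {s(e u, e v)} :=
      ⟨e.toEquiv, fun {a b} => by
        simp only [deleteEdges_pair_adj, RelIso.coe_fn_toEquiv, e.map_adj_iff,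
          e.injective.eq_iff]⟩
    exact not_hasDoubleReply_delete_cycleGraph _ _ (e.map_adj_iff.2 huv) (hr.of_iso e')

theorem nonempty_iso_cycleGraph {V : Type*} {G : SimpleGraph V} {d a p q b : V}
    (hdp : ¬ G.Adj d p) (hdq : ¬ G.Adj d q) (haq : ¬ G.Adj a q) (hab : ¬ G.Adj a b)
    (hpb : ¬ G.Adj p b) (hda : G.Adj d a) (hap : G.Adj a p) (hpq : G.Adj p q)
    (hqb : G.Adj q b) (hbd : G.Adj b d) (hV : ∀ v, v = d ∨ v = a ∨ v = p ∨ v = q ∨ v = b) :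
    Nonempty (G ≃g SimpleGraph.cycleGraph 5) := by
  have hinj : Function.Injective ![d, a, p, q, b] := by
    have := hda.ne; have := hap.ne; have := hpq.ne; have := hqb.ne; have := hbd.ne
    have := hda.symm; have := hap.symm; have := hpq.symm; have := hqb.symm; have := hbd.symm
    have : d ≠ p := by rintro rfl; exact hdq hpq
    have : d ≠ q := by rintro rfl; exact hdp ‹_›
    have : a ≠ q := by rintro rfl; exact hdq hda
    have : a ≠ b := by rintro rfl; exact haq ‹_›
    have : p ≠ b := by rintro rfl; exact hdp ‹_›
    intro i j hij
    fin_cases i <;> fin_cases j <;> simp at hij ⊢ <;> grind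
  have hsurj : Function.Surjective ![d, a, p, q, b] := by
    intro v
    rcases hV v with rfl | rfl | rfl | rfl | rfl
    · exact ⟨0, rfl⟩
    · exact ⟨1, rfl⟩
    · exact ⟨2, rfl⟩
    · exact ⟨3, rfl⟩
    · exact ⟨4, rfl⟩
  refine ⟨SimpleGraph.Iso.symm ⟨Equiv.ofBijective _ ⟨hinj, hsurj⟩, fun {i j} => ?_⟩⟩
  have h0 : ∀ i j : Fin 5, (SimpleGraph.cycleGraph 5).Adj i j ↔ (i = j + 1 ∨ j = i + 1) := by
    decide +kernel
  rw [h0]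
  change G.Adj (![d, a, p, q, b] i) (![d, a, p, q, b] j) ↔ _
  have := hda.symm; have := hap.symm; have := hpq.symm; have := hqb.symm; have := hbd.symm
  have := mt SimpleGraph.Adj.symm hdp; have := mt SimpleGraph.Adj.symm hdq; have := mt SimpleGraph.Adj.symm haq
  have := mt SimpleGraph.Adj.symm hab; have := mt SimpleGraph.Adj.symm hpb
  fin_cases i <;> fin_cases j <;> simp [*]

end Cycle

section Structure

variable {V : Type*} {G : SimpleGraph V}

theorem Critical2.exists_full (hG : Critical2 G) (hr : HasDoubleReply G)
    (tf : ∀ a b c, G.Adj a b → G.Adj b c → ¬ G.Adj a c) {x y : V} (hxy : G.Adj x y)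
    (hdom : DominatingPair G x y) : ∃ x', x' ≠ x ∧ ∀ v, G.Adj x v → G.Adj x' v := by
  by_contra! hno
  obtain ⟨d, p, q, hd, hp, hq, hpd, hqd, hpq, h1, h2⟩ := hr x
  have symm : ∀ a b, G.Adj a b → G.Adj b a := fun _ _ h => h.symm
  have side : ∀ v, G.Adj x v ∨ G.Adj y v := fun v => by
    have := hdom v
    grind
  have excl : ∀ v, G.Adj x v → ¬ G.Adj y v := fun v h h' => tf x v y h h'.symm hxy
  have sameY : ∀ u v, G.Adj y u → G.Adj y v → ¬ G.Adj u v := fun u v hu hv =>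
    tf u y v hu.symm hv
  have sameX : ∀ u v, G.Adj x u → G.Adj x v → ¬ G.Adj u v := fun u v hu hv =>
    tf u x v hu.symm hv
  rcases side d with hdx | hdy
  · have fin : ∀ p q, p ≠ x → q ≠ x → p ≠ d → q ≠ d → p ≠ q → DominatingPair G d p →
        DominatingPair G d q → G.Adj x p → False := by
      intro p q hp hq hpd hqd hpq h1 h2 hxp
      have hX2 : ∀ v, G.Adj x v → v = d ∨ v = p := fun v hv => by
        have := h1 v
        have := sameX d v hdx hv
        have := sameX p v hxp hv
        tauto
      have hqy : G.Adj y q := by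
        have := hX2 q
        have := side q
        tauto
      obtain ⟨w, hw, hw'⟩ := hno q hq
      have hqp : G.Adj q p := by
        have := h2 p
        have := sameX d p hdx hxp
        tauto
      have hdq : ¬ G.Adj d q := by
        have := hX2 w hw
        intro hn
        have := hn.symm
        grind
      have hyp : y = p := by
        have := hX2 y hxy
        grind
      subst hyp
      have hV : ∀ v, v = x ∨ v = d ∨ v = y ∨ v = q := by
        intro v
        rcases side v with hv | hv
        · have := hX2 v hv
          tauto
        · by_contra! hcon
          obtain ⟨z, hz, hz'⟩ := hno v hcon.1
          have hdv : G.Adj d v := by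
            have := h2 v
            have := sameY q v hqy hv
            tauto
          have := hX2 z hz
          grind
      exact not_critical2_of_path hq.symm hpd.symm hqd.symm hdx hqy hxy hV hG
    by_cases hxp : G.Adj x p
    · exact fin p q hp hq hpd hqd hpq h1 h2 hxp
    by_cases hxq : G.Adj x q
    · exact fin q p hq hp hqd hpd hpq.symm h2 h1 hxq
    have hyp : G.Adj y p := (side p).resolve_left hxp
    have hyq : G.Adj y q := (side q).resolve_left hxq
    have hdq : G.Adj d q := by
      have := h1 q
      have := sameY p q hyp hyq
      tauto
    obtain ⟨w, hw, hw'⟩ := hno q hq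
    have := h2 w
    have := sameX d w hdx hw
    have := hdq.symm
    grind
  · have hxd : ¬ G.Adj x d := fun h => excl d h hdy
    have ex : ∀ r, r ≠ x → DominatingPair G d r → G.Adj x r := by
      intro r hr' hrd
      by_contra hn
      have hyr := (side r).resolve_left hn
      have := hrd x
      have := sameY d x hdy hxy.symm
      have := sameY r x hyr hxy.symm
      tauto
    obtain ⟨w, hw, hw'⟩ := hno d hd
    have := h1 w
    have := h2 w
    have := sameX p w (ex p hp h1) hw
    have := sameX q w (ex q hq h2) hw
    grind

theorem Critical2.inFamilyB [Finite V] (hG : Critical2 G) (hr : HasDoubleReply G)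
    (tf : ∀ a b c, G.Adj a b → G.Adj b c → ¬ G.Adj a c) {x y : V} (hxy : G.Adj x y)
    (hdom : DominatingPair G x y) : InFamilyB G := by
  obtain ⟨x', hx', hfull⟩ := hG.exists_full hr tf hxy hdom
  obtain ⟨y', hy', hfull'⟩ := hG.exists_full hr tf hxy.symm
    (fun v => by have := hdom v; tauto)
  have side : ∀ v, ¬ G.Adj y v → G.Adj x v := fun v hv => by
    have := hdom v
    have := hxy.symm
    grind
  let S : Set V := {v | G.Adj y v}
  let G' : SimpleGraph V :=
    { Adj := fun u v => (u ∈ S ∧ v ∉ S ∧ (u = x ∨ u = x' ∨ v = y ∨ v = y')) ∨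
        (v ∈ S ∧ u ∉ S ∧ (v = x ∨ v = x' ∨ u = y ∨ u = y'))
      symm := ⟨fun u v h => by tauto⟩
      loopless := ⟨fun u h => by tauto⟩ }
  have hx'S : x' ∈ S := (hfull y hxy).symm
  have hy'S : y' ∉ S := tf y x y' hxy.symm (hfull' x hxy.symm).symm
  have hB : IsDoubleBiclique G' S x x' y y' :=
    ⟨hxy.symm, hx'S, hx'.symm, G.irrefl, hy'S, hy'.symm, fun u v => Iff.rfl⟩
  have hcross : ∀ u v, u ∈ S → v ∉ S → (u = x ∨ u = x' ∨ v = y ∨ v = y') → G.Adj u v := by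
    rintro u v hu hv (rfl | rfl | rfl | rfl)
    · exact side v hv
    · exact hfull v (side v hv)
    · exact SimpleGraph.Adj.symm hu
    · exact (hfull' u hu).symm
  have hle : G' ≤ G := by
    rintro u v (⟨h1, h2, h3⟩ | ⟨h1, h2, h3⟩)
    · exact hcross u v h1 h2 h3
    · exact (hcross v u h1 h2 h3).symm
  rw [hG.eq_of_le hle hB.hasDoubleReply.winsWithin2] at hB
  by_cases hb : ∃ b, b ≠ x ∧ b ≠ x' ∧ b ≠ y ∧ b ≠ y'
  · obtain ⟨b, h1, h2, h3, h4⟩ := hb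
    exact hB.inFamilyB h1 h2 h3 h4
  · refine absurd hG (not_critical2_of_path (a := x) (b := y) (c := y') (e := x') hx'.symm
      hy'.symm ?_ hxy ?_ ?_ ?_)
    · rintro rfl
      exact G.irrefl hx'S
    · exact hfull' x' hx'S
    · exact side y' hy'S
    · intro v
      by_contra hn
      exact hb ⟨v, by tauto⟩

theorem exists_common_neighbor (hconn : G.Connected) (hr : HasDoubleReply G)
    (tf : ∀ a b c, G.Adj a b → G.Adj b c → ¬ G.Adj a c)
    (hno : ∀ x y, G.Adj x y → ¬ DominatingPair G x y) {d p q : V} (hdp : ¬ G.Adj d p)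
    (hdq : ¬ G.Adj d q) (hpd : p ≠ d) (hqd : q ≠ d) (hpq : G.Adj p q)
    (hV : ∀ v, v = d ∨ v = p ∨ v = q ∨ G.Adj d v) : ∃ b, G.Adj d b ∧ G.Adj q b := by
  by_contra! hQ
  have symm : ∀ a b, G.Adj a b → G.Adj b a := fun _ _ h => h.symm
  obtain ⟨a, hda, hpa⟩ : ∃ a, G.Adj d a ∧ G.Adj p a := by
    by_contra! hP
    have := mem_of_connected (S := {p, q}) hconn (a := p) (by simp)
      (fun u v hu huv => by
        simp only [Set.mem_singleton_iff, Set.mem_insert_iff] at hu ⊢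
        have := hV v
        grind) d
    simp only [Set.mem_singleton_iff, Set.mem_insert_iff] at this
    grind
  obtain ⟨r, hdr, hpr⟩ : ∃ r, G.Adj d r ∧ ¬ G.Adj p r := by
    by_contra! hR
    refine hno p a hpa fun v => ?_
    have := hV v
    have := hR v
    have := hda.symm
    grind
  have key : ∀ u v, u ≠ p → v ≠ p → DominatingPair G u v →
      (u = q ∧ v = d) ∨ (u = d ∧ v = q) := by
    intro u v hu hv huv
    have qonly : ∀ w, G.Adj q w → w = p := fun w hw => by
      have := hV w
      have := hQ w
      have := G.ne_of_adj hw
      grind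
    have both : ∀ w, (w = a ∨ G.Adj w a) → (w = r ∨ G.Adj w r) → w ≠ p → w = d := by
      intro w h1 h2 h3
      have := tf a d r hda.symm hdr
      have := hV w
      have := tf a d w hda.symm
      have := qonly a
      grind
    have i1 := huv q
    have i2 := huv a
    have i3 := huv r
    have := both u
    have := both v
    have := qonly a
    have := qonly r
    have := qonly u
    have := qonly v
    grind
  obtain ⟨d', p', q', h1, h2, h3, h4, h5, h6, h7, h8⟩ := hr p
  have := key d' p' h1 h2 h7
  have := key d' q' h1 h3 h8
  grind

theorem common_neighbor_unique (hr : HasDoubleReply G)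
    (tf : ∀ a b c, G.Adj a b → G.Adj b c → ¬ G.Adj a c) {d p q a b : V}
    (hdq : ¬ G.Adj d q) (hpq : G.Adj p q)
    (hV : ∀ v, v = d ∨ v = p ∨ v = q ∨ G.Adj d v) (hda : G.Adj d a) (hpa : G.Adj p a)
    (hdb : G.Adj d b) (hqb : G.Adj q b) (a' : V) (hda' : G.Adj d a') (hpa' : G.Adj p a') :
    a' = a := by
  by_contra hne
  have symm : ∀ a b, G.Adj a b → G.Adj b a := fun _ _ h => h.symm
  have indep : ∀ u v, G.Adj d u → G.Adj d v → ¬ G.Adj u v := fun u v hu hv =>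
    tf u d v hu.symm hv
  have ca : ∀ z, G.Adj d z → G.Adj p z → ∀ w, w ≠ d → w = z ∨ G.Adj w z → w = z ∨ w = p := by
    intro z hz hz' w hw h
    have := hV w
    have := indep w z
    have := tf p q z hpq
    grind
  have cb : ∀ w, w ≠ d → w = b ∨ G.Adj w b → w = b ∨ w = q := by
    intro w hw h
    have := hV w
    have := indep w b
    have := tf q p b hpq.symm
    grind
  have hpb : ¬ G.Adj p b := tf p q b hpq hqb
  have key : ∀ u v, u ≠ d → v ≠ d → DominatingPair G u v →
      (u = p ∧ v = b) ∨ (u = b ∧ v = p) := by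
    intro u v hu hv huv
    have i1 := huv a
    have i2 := huv a'
    have i3 := huv b
    have i4 := huv d
    have := ca a hda hpa u hu
    have := ca a hda hpa v hv
    have := ca a' hda' hpa' u hu
    have := ca a' hda' hpa' v hv
    have := cb u hu
    have := cb v hv
    grind
  obtain ⟨d', p', q', h1, h2, h3, h4, h5, h6, h7, h8⟩ := hr d
  have := key d' p' h1 h2 h7
  have := key d' q' h1 h3 h8
  grind

theorem adj_or_adj_of_adj (hr : HasDoubleReply G)
    (tf : ∀ a b c, G.Adj a b → G.Adj b c → ¬ G.Adj a c) {d p q a b : V}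
    (hpq : G.Adj p q)
    (hV : ∀ v, v = d ∨ v = p ∨ v = q ∨ G.Adj d v) (hda : G.Adj d a) (hpa : G.Adj p a)
    (hdb : G.Adj d b) (hqb : G.Adj q b) (r : V) (hdr : G.Adj d r) :
    G.Adj p r ∨ G.Adj q r := by
  by_contra! hn
  have symm : ∀ a b, G.Adj a b → G.Adj b a := fun _ _ h => h.symm
  have indep : ∀ u v, G.Adj d u → G.Adj d v → ¬ G.Adj u v := fun u v hu hv =>
    tf u d v hu.symm hv
  have hqa : ¬ G.Adj q a := tf q p a hpq.symm hpa
  have hpb : ¬ G.Adj p b := tf p q b hpq hqb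
  have key : ∀ u v, u ≠ d → v ≠ d → ¬ DominatingPair G u v := by
    intro u v hu hv huv
    have cr : ∀ w, w ≠ d → w = r ∨ G.Adj w r → w = r := by
      intro w hw h
      have := hV w
      have := indep w r
      grind
    have ca : ∀ w, w ≠ d → w = a ∨ G.Adj w a → w = a ∨ w = p := by
      intro w hw h
      have := hV w
      have := indep w a
      grind
    have cb : ∀ w, w ≠ d → w = b ∨ G.Adj w b → w = b ∨ w = q := by
      intro w hw h
      have := hV w
      have := indep w b
      grind
    have i1 := huv a
    have i2 := huv r
    have i3 := huv b
    have := ca u hu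
    have := ca v hv
    have := cr u hu
    have := cr v hv
    have := cb u hu
    have := cb v hv
    have := G.ne_of_adj hpq
    have := indep a b hda hdb
    grind
  obtain ⟨d', p', q', h1, h2, h3, h4, h5, h6, h7, h8⟩ := hr d
  exact key d' p' h1 h2 h7

theorem nonempty_iso_cycleGraph_of_hasDoubleReply (hconn : G.Connected) (hr : HasDoubleReply G)
    (tf : ∀ a b c, G.Adj a b → G.Adj b c → ¬ G.Adj a c)
    (hno : ∀ x y, G.Adj x y → ¬ DominatingPair G x y) :
    Nonempty (G ≃g SimpleGraph.cycleGraph 5) := by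
  obtain ⟨s⟩ := hconn.nonempty
  obtain ⟨d, p, q, -, -, -, hpd, hqd, hne, h1, h2⟩ := hr s
  have hdp : ¬ G.Adj d p := fun h => hno _ _ h h1
  have hdq : ¬ G.Adj d q := fun h => hno _ _ h h2
  have hpq : G.Adj p q := by
    have := h1 q
    tauto
  have hV : ∀ v, v = d ∨ v = p ∨ v = q ∨ G.Adj d v := by
    intro v
    have := h1 v
    have := h2 v
    have := tf p q v hpq
    tauto
  have hV' : ∀ v, v = d ∨ v = q ∨ v = p ∨ G.Adj d v := fun v => by
    have := hV v
    tauto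
  obtain ⟨b, hdb, hqb⟩ := exists_common_neighbor hconn hr tf hno hdp hdq hpd hqd hpq hV
  obtain ⟨a, hda, hpa⟩ := exists_common_neighbor hconn hr tf hno hdq hdp hqd hpd hpq.symm hV'
  have ua := common_neighbor_unique hr tf hdq hpq hV hda hpa hdb hqb
  have ub := common_neighbor_unique hr tf hdp hpq.symm hV' hdb hqb hda hpa
  have cover := adj_or_adj_of_adj hr tf hpq hV hda hpa hdb hqb
  refine nonempty_iso_cycleGraph hdp hdq (tf a p q hpa.symm hpq) (tf a d b hda.symm hdb)
    (tf p q b hpq hqb) hda hpa.symm hpq hqb hdb.symm fun v => ?_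
  have := hV v
  have := ua v
  have := ub v
  have := cover v
  tauto

end Structure

theorem stmt0 {V : Type*} [Fintype V] (G : SimpleGraph V)
    (hconn : G.Connected) (htf : G.CliqueFree 3) :
    Critical2 G ↔ (InFamilyB G ∨ Nonempty (G ≃g SimpleGraph.cycleGraph 5)) := by
  have tf : ∀ a b c, G.Adj a b → G.Adj b c → ¬ G.Adj a c := by
    classical
    intro a b c hab hbc hac
    exact htf {a, b, c} (SimpleGraph.is3Clique_triple_iff.2 ⟨hab, hac, hbc⟩)
  constructor
  · intro hG
    have hr := hG.1.hasDoubleReply hconn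
    by_cases h : ∃ x y, G.Adj x y ∧ DominatingPair G x y
    · obtain ⟨x, y, hxy, hdom⟩ := h
      exact Or.inl (hG.inFamilyB hr tf hxy hdom)
    · push Not at h
      exact Or.inr (nonempty_iso_cycleGraph_of_hasDoubleReply hconn hr tf h)
  · rintro (h | ⟨⟨e⟩⟩)
    · obtain ⟨S, x, x', y, y', b, hB, h1, h2, h3, h4⟩ := h.exists_isDoubleBiclique
      exact hB.critical2 h1 h2 h3 h4
    · exact critical2_of_iso_cycleGraph e
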